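/- arXiv:2502.03762 — 2 statements merged into one kernel-verified Lean document; each statement's English description precedes it below -/
import Mathlib

section
/- Let S be a finite type, u_max ∈ ℕ, and let π : S → List AP → D be a prefix tree policy induced by a reward machine model A with at most u_max nodes via a product policy r, i.e. π(s,σ) = r(δ_A*(u_A,σ), s) for every feasible word σ and every s ∈ Reach(σ). Let B be a deterministic finite automaton over AP with node set U_B of cardinality at most u_max, initial node u_B, and transition δ_B, and suppose that for all feasible words σ, σ' of length at most (Fintype.card S)·u_max² and every state s ∈ Reach(σ) ∩ Reach(σ'): π(s,σ) ≠ π(s,σ') implies δ_B*(u_B,σ) ≠ δ_B*(u_B,σ'). Then there exists g : U_B → S → D such that g(δ_B*(u_B,σ), s) = π(s,σ) for every feasible word σ of arbitrary length and every s ∈ Reach(σ). (Theorem 1: any machine with at most u_max nodes that separates all negative examples up to depth |S|·u_max² induces the full, infinite-depth true prefix tree policy, i.e. is policy-equivalent to the true reward machine.) -/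
/-- A trajectory of a labeled transition system: a nonempty list of states whose
head is an initial state and whose consecutive elements are related by `step`. -/
def IsTraj {S : Type*} (step : S → S → Prop) (S0 : Set S) (τ : List S) : Prop :=
  τ ≠ [] ∧ (∀ h : τ ≠ [], τ.head h ∈ S0) ∧ τ.Chain' step

/-- A word over `AP` is feasible if some trajectory generates it. -/
def Feasible {S AP : Type*} (step : S → S → Prop) (S0 : Set S) (L : S → AP)
    (σ : List AP) : Prop :=
  ∃ τ : List S, IsTraj step S0 τ ∧ τ.map L = σ

/-- The set of states at which some trajectory generating `σ` ends. -/
def Reach {S AP : Type*} (step : S → S → Prop) (S0 : Set S) (L : S → AP)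
    (σ : List AP) : Set S :=
  { s | ∃ τ : List S, IsTraj step S0 τ ∧ τ.map L = σ ∧ τ.getLast? = some s }

section Shortening

variable {S AP U : Type*} {step : S → S → Prop} {S0 : Set S}

theorem isTraj_iff {τ : List S} : IsTraj step S0 τ ↔
    τ ≠ [] ∧ (∀ h : τ ≠ [], τ.head h ∈ S0) ∧ τ.IsChain step :=
  Iff.rfl

theorem isTraj_concat_iff {τ : List S} {x : S} (hτ : τ ≠ []) :
    IsTraj step S0 (τ ++ [x]) ↔
      IsTraj step S0 τ ∧ ∀ y ∈ τ.getLast?, step y x := by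
  simp [isTraj_iff, List.isChain_append, List.head_append_of_ne_nil, hτ, and_assoc]

theorem IsTraj.of_prefix {p τ : List S} (h : IsTraj step S0 τ) (hp : p <+: τ) (hne : p ≠ []) :
    IsTraj step S0 p := by
  obtain ⟨q, rfl⟩ := hp
  obtain ⟨-, hhead, hchain⟩ := h
  refine ⟨hne, fun h => ?_, List.IsChain.left_of_append hchain⟩
  simpa [List.head_append_of_ne_nil, hne] using hhead (by simp [hne])

/-- Nonempty prefixes of `τ` are determined by their last state and the value of `e` on their
labels. -/
def LoopFree (L : S → AP) (e : List AP → U) (τ : List S) : Prop :=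
  ∀ p q, p <+: τ → q <+: τ → p ≠ [] → q ≠ [] → p.getLast? = q.getLast? →
    e (p.map L) = e (q.map L) → p = q

theorem LoopFree.of_prefix {L : S → AP} {e : List AP → U} {p τ : List S}
    (h : LoopFree L e τ) (hp : p <+: τ) : LoopFree L e p :=
  fun a b ha hb => h a b (ha.trans hp) (hb.trans hp)

theorem LoopFree.length_le [Fintype S] [Fintype U] {L : S → AP} {e : List AP → U} {τ : List S}
    (h : LoopFree L e τ) : τ.length ≤ Fintype.card S * Fintype.card U := by
  let f : Fin τ.length → S × U := fun i => (τ[i], e ((τ.take (i + 1)).map L))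
  have hf : Function.Injective f := by
    intro i j hij
    obtain ⟨hs, hu⟩ := Prod.mk.inj hij
    have hne : ∀ k : Fin τ.length, τ.take (k + 1) ≠ [] := fun k hk => by
      have := congrArg List.length hk
      have := k.2
      simp only [List.length_take, List.length_nil] at *
      omega
    have hlast : ∀ k : Fin τ.length, (τ.take (k + 1)).getLast? = some τ[k] := fun k => by
      rw [List.take_add_one, List.getElem?_eq_getElem k.2, Option.toList_some,
        List.getLast?_concat]
      rfl
    have := congrArg List.length (h _ _ (List.take_prefix _ _) (List.take_prefix _ _)
      (hne i) (hne j) (by rw [hlast, hlast, hs]) hu)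
    simp only [List.length_take] at this
    have := i.2
    have := j.2
    ext
    omega
  simpa using Fintype.card_le_of_injective f hf

theorem IsTraj.exists_loopFree (L : S → AP) (e : List AP → U)
    (he : ∀ σ σ' a, e σ = e σ' → e (σ ++ [a]) = e (σ' ++ [a])) {τ : List S}
    (hτ : IsTraj step S0 τ) :
    ∃ τ', IsTraj step S0 τ' ∧ τ'.getLast? = τ.getLast? ∧ e (τ'.map L) = e (τ.map L) ∧
      LoopFree L e τ' := by
  induction τ using List.reverseRecOn with
  | nil => exact absurd rfl hτ.1
  | append_singleton t x ih =>
    by_cases ht : t = []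
    · subst ht
      refine ⟨[] ++ [x], hτ, rfl, rfl, fun p q hp hq hp0 hq0 _ _ => ?_⟩
      rw [List.nil_append, List.prefix_cons_iff] at hp hq
      simp_all
    obtain ⟨htraj, hstep⟩ := (isTraj_concat_iff ht).1 hτ
    obtain ⟨t', ht', hlast, heq, hfree⟩ := ih htraj
    have heq' : e ((t' ++ [x]).map L) = e ((t ++ [x]).map L) := by
      simpa using he _ _ (L x) heq
    by_cases hex : ∃ p, p <+: t' ∧ p ≠ [] ∧ p.getLast? = some x ∧
        e (p.map L) = e ((t' ++ [x]).map L)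
    · obtain ⟨p, hp, hp0, hpx, hpe⟩ := hex
      exact ⟨p, ht'.of_prefix hp hp0, by simpa using hpx, hpe.trans heq', hfree.of_prefix hp⟩
    · refine ⟨t' ++ [x], (isTraj_concat_iff ht'.1).2 ⟨ht', hlast ▸ hstep⟩, by simp, heq', ?_⟩
      intro p q hp hq hp0 hq0 hpq hepq
      rcases List.prefix_concat_iff.1 hp with rfl | hp <;>
        rcases List.prefix_concat_iff.1 hq with rfl | hq
      · rfl
      · exact absurd ⟨q, hq, hq0, by simpa using hpq.symm, hepq.symm⟩ hex
      · exact absurd ⟨p, hp, hp0, by simpa using hpq, hepq⟩ hex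
      · exact hfree p q hp hq hp0 hq0 hpq hepq

theorem exists_short_word [Fintype S] [Fintype U] {L : S → AP} (e : List AP → U)
    (he : ∀ σ σ' a, e σ = e σ' → e (σ ++ [a]) = e (σ' ++ [a])) {σ : List AP} {s : S}
    (hs : s ∈ Reach step S0 L σ) :
    ∃ σ', s ∈ Reach step S0 L σ' ∧ e σ' = e σ ∧
      σ'.length ≤ Fintype.card S * Fintype.card U := by
  obtain ⟨τ, hτ, rfl, hlast⟩ := hs
  obtain ⟨τ', hτ', hlast', heq, hfree⟩ := hτ.exists_loopFree L e he
  exact ⟨τ'.map L, ⟨τ', hτ', rfl, hlast'.trans hlast⟩, heq, by simpa using hfree.length_le⟩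

theorem feasible_of_mem_reach {L : S → AP} {σ : List AP} {s : S}
    (hs : s ∈ Reach step S0 L σ) : Feasible step S0 L σ :=
  let ⟨τ, hτ, hL, _⟩ := hs
  ⟨τ, hτ, hL⟩

end Shortening

/-- Theorem 1: any DFA `B` with at most `u_max` nodes that separates all negative
examples of the true prefix tree policy up to depth `|S| * u_max ^ 2` induces the
full, infinite-depth true prefix tree policy. -/
theorem thm1_policy_equivalence {S AP D UA UB : Type*}
    [Fintype S] [Fintype AP] [Fintype UA] [Fintype UB]
    (step : S → S → Prop) (S0 : Set S) (L : S → AP)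
    (u_max : ℕ) (hA : Fintype.card UA ≤ u_max) (hB : Fintype.card UB ≤ u_max)
    (A : DFA AP UA) (r : UA → S → D) (π : S → List AP → D)
    (hind : ∀ σ, Feasible step S0 L σ → ∀ s ∈ Reach step S0 L σ,
      π s σ = r (A.evalFrom A.start σ) s)
    (B : DFA AP UB)
    (hsep : ∀ σ σ', Feasible step S0 L σ → Feasible step S0 L σ' →
      σ.length ≤ Fintype.card S * u_max ^ 2 → σ'.length ≤ Fintype.card S * u_max ^ 2 →
      ∀ s, s ∈ Reach step S0 L σ → s ∈ Reach step S0 L σ' →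
        π s σ ≠ π s σ' → B.evalFrom B.start σ ≠ B.evalFrom B.start σ') :
    ∃ g : UB → S → D, ∀ σ, Feasible step S0 L σ →
      ∀ s ∈ Reach step S0 L σ, g (B.evalFrom B.start σ) s = π s σ := by
  classical
  have short : ∀ σ s, s ∈ Reach step S0 L σ → ∃ σ', s ∈ Reach step S0 L σ' ∧
      π s σ' = π s σ ∧ B.evalFrom B.start σ' = B.evalFrom B.start σ ∧
      σ'.length ≤ Fintype.card S * u_max ^ 2 := by
    intro σ s hs
    obtain ⟨σ', hs', heq, hlen⟩ := exists_short_word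
      (fun σ => (A.evalFrom A.start σ, B.evalFrom B.start σ))
      (fun σ σ' a h => by
        simp only [Prod.mk.injEq] at h
        simp only [DFA.evalFrom_append_singleton, h.1, h.2]) hs
    simp only [Prod.mk.injEq] at heq
    refine ⟨σ', hs', ?_, heq.2, hlen.trans ?_⟩
    · rw [hind σ' (feasible_of_mem_reach hs') s hs', hind σ (feasible_of_mem_reach hs) s hs, heq.1]
    · rw [Fintype.card_prod, sq]
      gcongr
  have key : ∀ σ σ' s, s ∈ Reach step S0 L σ → s ∈ Reach step S0 L σ' →
      B.evalFrom B.start σ = B.evalFrom B.start σ' → π s σ = π s σ' := by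
    intro σ σ' s hs hs' hB
    obtain ⟨ρ, hρ, hπ, hb, hlen⟩ := short σ s hs
    obtain ⟨ρ', hρ', hπ', hb', hlen'⟩ := short σ' s hs'
    rw [← hπ, ← hπ']
    by_contra hne
    exact hsep ρ ρ' (feasible_of_mem_reach hρ) (feasible_of_mem_reach hρ') hlen hlen' s hρ hρ' hne
      (hb.trans (hB.trans hb'.symm))
  refine ⟨fun u s => if h : ∃ σ, s ∈ Reach step S0 L σ ∧ B.evalFrom B.start σ = u then
    π s h.choose else π s [], fun σ _ s hs => ?_⟩
  have h : ∃ σ', s ∈ Reach step S0 L σ' ∧ B.evalFrom B.start σ' = B.evalFrom B.start σ :=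
    ⟨σ, hs, rfl⟩
  simp only [dif_pos h]
  exact key _ _ s h.choose_spec.1 hs h.choose_spec.2
end

section
/- Let A be a deterministic finite automaton over the alphabet AP with node set U_A of cardinality n, initial node u_A, and transition function δ_A. Then for every feasible word σ and every state s ∈ Reach(σ), there exists a feasible word σ̄ of length at most (Fintype.card S)·n such that s ∈ Reach(σ̄) and δ_A*(u_A,σ̄) = δ_A*(u_A,σ). (Every reachable product state of the labeled transition system with a reward machine model is reached by a feasible word of length at most |S|·|U_A|, obtained by removing cycles.) -/
/-- An initial segment of a trajectory may be exchanged for any trajectory with the same last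
state. -/
theorem IsTraj.append_of_getLast?_eq {S : Type*} {step : S → S → Prop} {S0 : Set S}
    {a b c : List S} (ha : IsTraj step S0 a) (hbc : IsTraj step S0 (b ++ c))
    (h : a.getLast? = b.getLast?) : IsTraj step S0 (a ++ c) := by
  obtain ⟨hne, hhead, hchain⟩ := ha
  obtain ⟨-, hc, hlink⟩ := List.isChain_append.1 hbc.2.2
  refine ⟨by simp [hne], fun _ => ?_, List.isChain_append.2 ⟨hchain, hc, h ▸ hlink⟩⟩
  rw [List.head_append_of_ne_nil hne]
  exact hhead hne

theorem IsTraj.take_succ {S : Type*} {step : S → S → Prop} {S0 : Set S} {τ : List S}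
    (hτ : IsTraj step S0 τ) (i : ℕ) : IsTraj step S0 (τ.take (i + 1)) := by
  obtain ⟨hne, hhead, hchain⟩ := hτ
  refine ⟨by simp [hne], fun _ => ?_, hchain.take _⟩
  rw [List.head_take]
  exact hhead hne

/-- A trajectory longer than the number of product states contains a cycle, which can be removed
without changing the final product state. -/
theorem IsTraj.exists_shorter {S AP UA : Type*} [Fintype S] [Fintype UA]
    {step : S → S → Prop} {S0 : Set S} (L : S → AP) (A : DFA AP UA) {τ : List S}
    (hτ : IsTraj step S0 τ) (hlen : Fintype.card S * Fintype.card UA < τ.length) :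
    ∃ τ' : List S, IsTraj step S0 τ' ∧ τ'.length < τ.length ∧ τ'.getLast? = τ.getLast? ∧
      A.evalFrom A.start (τ'.map L) = A.evalFrom A.start (τ.map L) := by
  obtain ⟨i, j, hne, heq⟩ := Fintype.exists_ne_map_eq_of_card_lt
    (fun i : Fin τ.length => (τ[i], A.evalFrom A.start ((τ.take (i + 1)).map L)))
    (by simpa using hlen)
  wlog hlt : i < j generalizing i j
  · exact this j i hne.symm heq.symm (lt_of_le_of_ne (not_lt.1 hlt) hne.symm)
  obtain ⟨hstate, heval⟩ := Prod.ext_iff.1 heq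
  have hlast : (τ.take (i + 1)).getLast? = (τ.take (j + 1)).getLast? := by
    simpa [List.getLast?_take] using hstate
  have hsplit : τ.take (j + 1) ++ τ.drop (j + 1) = τ := List.take_append_drop _ _
  refine ⟨τ.take (i + 1) ++ τ.drop (j + 1), ?_, ?_, ?_, ?_⟩
  · exact (hτ.take_succ i).append_of_getLast?_eq (hsplit.symm ▸ hτ) hlast
  · have := j.isLt
    have : (i : ℕ) < j := hlt
    simp only [List.length_append, List.length_take, List.length_drop]
    omega
  · conv_rhs => rw [← hsplit]
    rw [List.getLast?_append, List.getLast?_append, hlast]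
  · conv_rhs => rw [← hsplit]
    rw [List.map_append, List.map_append, DFA.evalFrom_of_append, DFA.evalFrom_of_append]
    exact congrArg (A.evalFrom · _) heval

/-- Every reachable product state of the labeled transition system with a reward
machine model is reached by a feasible word of length at most `|S| * n`. -/
theorem cycle_removal_product {S AP UA : Type*}
    [Fintype S] [Fintype AP] [Fintype UA]
    (step : S → S → Prop) (S0 : Set S) (L : S → AP)
    (n : ℕ) (hn : Fintype.card UA = n)
    (A : DFA AP UA)
    (σ : List AP) (hσ : Feasible step S0 L σ) (s : S) (hs : s ∈ Reach step S0 L σ) :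
    ∃ σ' : List AP, Feasible step S0 L σ' ∧ σ'.length ≤ Fintype.card S * n ∧
      s ∈ Reach step S0 L σ' ∧
      A.evalFrom A.start σ' = A.evalFrom A.start σ := by
  obtain ⟨τ, hτ, rfl, hlast⟩ := hs
  clear hσ
  subst hn
  induction hk : τ.length using Nat.strong_induction_on generalizing τ with
  | _ k ih =>
    by_cases hlen : τ.length ≤ Fintype.card S * Fintype.card UA
    · exact ⟨τ.map L, ⟨τ, hτ, rfl⟩, by simpa using hlen, ⟨τ, hτ, rfl, hlast⟩, rfl⟩
    · obtain ⟨τ', hτ', hlt, hlast', heval⟩ := hτ.exists_shorter L A (not_le.1 hlen)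
      rw [← heval]
      exact ih _ (hk ▸ hlt) τ' hτ' (hlast'.trans hlast) rfl
end
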